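/- Let X = {t_1 > … > t_k} ⊆ [n], let t = t_i ∈ E(X) and j = t/2. Define the words r_1 := w_{t_1} ++ … ++ w_{t_{i−1}} ++ w_{t−1} ++ w_{t−3} ++ … ++ w_3 ++ w_1 and r_2 := w_{t−1, t_{i+1}} ++ w_{t−3, t_{i+2}} ++ … ++ w_{1, t_{i+j}} ++ w_{t_{i+j+1}} ++ … ++ w_{t_k} (these are well defined: t ∈ E(X) implies i + j ≤ k and t − (2a − 1) ≤ t_{i+a} for all 1 ≤ a ≤ j). Then r_1 ++ r_2 is a reduced word whose product is the element of ᴵW corresponding to X ∖ {t}; in particular the element of ᴵW corresponding to X ∖ {t} has length ℓ(X) − t, where ℓ(X) = t_1 + … + t_k. -/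

import Mathlib

open List

/-- The Coxeter matrix of type `Bₙ` with the 4-bond between `s₀` and `s₁`. -/
def BCox (n : ℕ) : CoxeterMatrix (Fin n) where
  M := Matrix.of fun i j : Fin n ↦
    if i = j then 1
      else if (i : ℕ) + (j : ℕ) = 1 then 4
      else if (j : ℕ) + 1 = (i : ℕ) ∨ (i : ℕ) + 1 = (j : ℕ) then 3 else 2
  isSymm := by
    unfold Matrix.IsSymm
    ext i j
    simp only [Matrix.transpose_apply, Matrix.of_apply]
    rcases eq_or_ne i j with h | h
    · subst h; simp
    · rw [if_neg h, if_neg (Ne.symm h)]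
      split_ifs <;> omega
  diagonal := by simp
  off_diagonal := by
    intro i j hij
    simp only [Matrix.of_apply, if_neg hij]
    split_ifs <;> simp

/-- The right action of the generator `sᵢ` on subsets of `{1, …, n}`:
`s₀` toggles membership of `1`; for `i ≥ 1`, `sᵢ` interchanges the membership
status of `i` and `i + 1`. -/
def bAct (n : ℕ) (X : Finset ℕ) (i : Fin n) : Finset ℕ :=
  if (i : ℕ) = 0 then (if 1 ∈ X then X.erase 1 else insert 1 X)
  else if (i : ℕ) ∈ X ∧ (i : ℕ) + 1 ∉ X then insert ((i : ℕ) + 1) (X.erase (i : ℕ))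
  else if (i : ℕ) + 1 ∈ X ∧ (i : ℕ) ∉ X then insert (i : ℕ) (X.erase ((i : ℕ) + 1))
  else X

/-- The set `ᴵW` of minimal length representatives of the cosets `W_I∖W`,
where `I = {s₁, …, s_{n−1}}`. -/
def IWset {n : ℕ} {W : Type*} [Group W] (cs : CoxeterSystem (BCox n) W) : Set W :=
  {x | ∀ i : Fin n, (i : ℕ) ≠ 0 → cs.length x < cs.length (cs.simple i * x)}

/-- `x` corresponds to the subset `X ⊆ {1, …, n}` under the bijection `ᴵW ≅ 𝒫([n])`;
that is, `X = ∅ · x` for the right action of `W` on subsets. -/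
def corr {n : ℕ} {W : Type*} [Group W] (cs : CoxeterSystem (BCox n) W) (x : W)
    (X : Finset ℕ) : Prop :=
  ∃ w : List (Fin n), cs.wordProd w = x ∧ w.foldl (bAct n) ∅ = X

/-- The word `w_a = (s₀, s₁, …, s_{a−1})`. -/
def rowWord (n a : ℕ) : List (Fin n) :=
  (List.range a).filterMap fun j => if h : j < n then some (⟨j, h⟩ : Fin n) else none

/-- The word `w_{a,b} = (s_a, s_{a+1}, …, s_{b−1})`. -/
def rowWord2 (n a b : ℕ) : List (Fin n) :=
  (List.range' a (b - a)).filterMap fun j => if h : j < n then some (⟨j, h⟩ : Fin n) else none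

open Classical in
/-- The set `E(X)`: those even `t ∈ X` such that for every `k` with `t > k ≥ 1` there are
strictly more elements `t'` of `X` with `t > t' ≥ k` than elements `t'` of `[n] ∖ X` with
`t > t' ≥ k`. -/
noncomputable def Eset (n : ℕ) (X : Finset ℕ) : Finset ℕ :=
  X.filter fun t => Even t ∧ ∀ k ∈ Finset.Ico 1 t,
    ((X.filter fun t' => k ≤ t' ∧ t' < t).card
      > ((Finset.Icc 1 n \ X).filter fun t' => k ≤ t' ∧ t' < t).card)

theorem mem_bAct (n : ℕ) (X : Finset ℕ) (i : Fin n) (k : ℕ) :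
    k ∈ bAct n X i ↔ (if (i : ℕ) = 0 then (if k = 1 then 1 ∉ X else k ∈ X)
      else if k = i then (i : ℕ) + 1 ∈ X else if k = i + 1 then (i : ℕ) ∈ X else k ∈ X) := by
  unfold bAct
  split_ifs <;> simp_all <;> grind

/-- The right action, as a map into the opposite of the endomorphism monoid. -/
def actGen (n : ℕ) (i : Fin n) : (Function.End (Finset ℕ))ᵐᵒᵖ :=
  MulOpposite.op (fun X => bAct n X i)

theorem actGen_mul_unop (n : ℕ) (g : (Function.End (Finset ℕ))ᵐᵒᵖ) (i : Fin n) (X : Finset ℕ) :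
    (g * actGen n i).unop X = bAct n (g.unop X) i := rfl

theorem actGen_unop (n : ℕ) (i : Fin n) (X : Finset ℕ) :
    (actGen n i).unop X = bAct n X i := rfl

theorem actGen_liftable (n : ℕ) : (BCox n).IsLiftable (actGen n) := by
  intro i j
  apply MulOpposite.unop_injective
  funext X
  have h1 : (MulOpposite.unop (1 : (Function.End (Finset ℕ))ᵐᵒᵖ)) X = X := rfl
  rw [h1]
  ext k
  have hM : (BCox n) i j = if i = j then 1
      else if (i : ℕ) + (j : ℕ) = 1 then 4
      else if (j : ℕ) + 1 = (i : ℕ) ∨ (i : ℕ) + 1 = (j : ℕ) then 3 else 2 := rfl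
  rw [hM]
  split_ifs with a b c
  · subst a
    simp only [pow_succ, pow_zero, one_mul, ← mul_assoc, actGen_mul_unop, actGen_unop, mem_bAct]
    grind
  · have : ((i : ℕ) = 0 ∧ (j : ℕ) = 1) ∨ ((i : ℕ) = 1 ∧ (j : ℕ) = 0) := by omega
    simp only [pow_succ, pow_zero, one_mul, ← mul_assoc, actGen_mul_unop, actGen_unop]
    rcases this with ⟨h, h'⟩ | ⟨h, h'⟩ <;>
    · simp only [mem_bAct, h, h']
      by_cases k1 : k = 1
      · subst k1; simp
      · by_cases k2 : k = 2
        · subst k2; simp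
        · simp [k1, k2]
  · simp only [pow_succ, pow_zero, one_mul, ← mul_assoc, actGen_mul_unop, actGen_unop]
    rcases c with c | c
    · have hj : (j : ℕ) ≠ 0 := by omega
      have e1 : (j : ℕ) + 1 + 1 ≠ j := by omega
      simp only [mem_bAct, ← c]
      by_cases k1 : k = j
      · subst k1; simp [hj, e1, e1.symm]
      · by_cases k2 : k = j + 1
        · subst k2; simp [hj, e1, e1.symm]
        · by_cases k3 : k = j + 1 + 1
          · subst k3; simp [hj, e1, e1.symm]
          · simp [hj, k1, k2, k3]
    · have hj : (i : ℕ) ≠ 0 := by omega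
      have e1 : (i : ℕ) + 1 + 1 ≠ i := by omega
      simp only [mem_bAct, ← c]
      by_cases k1 : k = i
      · subst k1; simp [hj, e1, e1.symm]
      · by_cases k2 : k = i + 1
        · subst k2; simp [hj, e1, e1.symm]
        · by_cases k3 : k = i + 1 + 1
          · subst k3; simp [hj, e1, e1.symm]
          · simp [hj, k1, k2, k3]
  · simp only [pow_succ, pow_zero, one_mul, ← mul_assoc, actGen_mul_unop, actGen_unop]
    have a' : (i : ℕ) ≠ j := fun h => a (Fin.ext h)
    simp only [mem_bAct]
    grind

theorem foldl_eq_lift {n : ℕ} {W : Type*} [Group W] (cs : CoxeterSystem (BCox n) W)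
    (w : List (Fin n)) (X : Finset ℕ) :
    w.foldl (bAct n) X
      = (cs.lift ⟨actGen n, actGen_liftable n⟩ (cs.wordProd w)).unop X := by
  induction w using List.reverseRecOn with
  | nil => simp; rfl
  | append_singleton l i ih =>
    rw [List.foldl_append, cs.wordProd_append, map_mul, cs.wordProd_singleton,
      cs.lift_apply_simple]
    simp only [List.foldl_cons, List.foldl_nil, ih]
    rfl

theorem sum_bAct_le (n : ℕ) (X : Finset ℕ) (i : Fin n) :
    (bAct n X i).sum id ≤ X.sum id + 1 := by
  unfold bAct
  split_ifs with h1 h2 h3 h4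
  · have := Finset.add_sum_erase X id h2
    simp only [id] at *; omega
  · rw [Finset.sum_insert h2]; simp; omega
  · have := Finset.add_sum_erase X id h3.1
    rw [Finset.sum_insert (by simp [h3.2])]
    simp only [id] at *; omega
  · have := Finset.add_sum_erase X id h4.1
    rw [Finset.sum_insert (by simp [h4.2])]
    simp only [id] at *; omega
  · exact Nat.le_succ _

theorem sum_foldl_le (n : ℕ) (w : List (Fin n)) (X : Finset ℕ) :
    (w.foldl (bAct n) X).sum id ≤ X.sum id + w.length := by
  induction w generalizing X with
  | nil => simp
  | cons a l ih =>
    have := ih (bAct n X a)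
    have := sum_bAct_le n X a
    simp only [List.foldl_cons, List.length_cons]; omega

/-- The length of any element is bounded below by the sum of the corresponding subset. -/
theorem sum_le_length {n : ℕ} {W : Type*} [Group W] (cs : CoxeterSystem (BCox n) W)
    (w : List (Fin n)) : (w.foldl (bAct n) ∅).sum id ≤ cs.length (cs.wordProd w) := by
  obtain ⟨v, hv, hv'⟩ := cs.exists_isReduced (cs.wordProd w)
  rw [foldl_eq_lift cs, hv', ← foldl_eq_lift cs]
  have hv2 : cs.length (cs.wordProd v) = v.length := hv
  rw [hv2]
  simpa using sum_foldl_le n v ∅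

theorem bAct_empty (n : ℕ) (i : Fin n) (hi : (i : ℕ) ≠ 0) : bAct n ∅ i = ∅ := by
  simp [bAct, hi]

/-- The general principle: a word whose number of letters is the sum of its subset. -/
theorem good_word {n : ℕ} {W : Type*} [Group W] (cs : CoxeterSystem (BCox n) W)
    (w : List (Fin n)) (X : Finset ℕ) (hX : w.foldl (bAct n) ∅ = X)
    (hl : w.length = X.sum id) :
    cs.IsReduced w ∧ cs.wordProd w ∈ IWset cs ∧ corr cs (cs.wordProd w) X ∧
      cs.length (cs.wordProd w) = X.sum id := by
  have h1 := sum_le_length cs w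
  have h2 := cs.length_wordProd_le w
  rw [hX] at h1
  have h3 : cs.length (cs.wordProd w) = X.sum id := by omega
  refine ⟨?_, ?_, ⟨w, rfl, hX⟩, h3⟩
  · unfold CoxeterSystem.IsReduced; omega
  · intro i hi
    have h4 := sum_le_length cs (i :: w)
    rw [List.foldl_cons, bAct_empty n i hi, hX, cs.wordProd_cons] at h4
    have := cs.length_simple_mul_ne (cs.wordProd w) i
    omega

theorem rowWord_eq (n a : ℕ) : rowWord n a = rowWord2 n 0 a := by
  simp [rowWord, rowWord2, List.range_eq_range']

theorem rowWord2_succ (n a b : ℕ) (hab : a ≤ b) (hb : b < n) :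
    rowWord2 n a (b + 1) = rowWord2 n a b ++ [⟨b, hb⟩] := by
  unfold rowWord2
  have : b + 1 - a = (b - a) + 1 := by omega
  rw [this, List.range'_concat, List.filterMap_append]
  have : a + (b - a) = b := by omega
  simp [this, hb]

theorem rowWord2_self (n a : ℕ) : rowWord2 n a a = [] := by simp [rowWord2]

theorem length_rowWord2 (n a b : ℕ) (hab : a ≤ b) (hb : b ≤ n) :
    (rowWord2 n a b).length = b - a := by
  induction b, hab using Nat.le_induction with
  | base => simp [rowWord2_self]
  | succ b h ih =>
    rw [rowWord2_succ n a b h hb, List.length_append, ih (by omega)]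
    simp; omega

theorem foldl_rowWord2 (n a b : ℕ) (hab : a ≤ b) (ha : 1 ≤ a) (hb : b ≤ n) (Y : Finset ℕ)
    (hY : a ∈ Y) (hY' : ∀ c ∈ Y, a < c → b < c) :
    (rowWord2 n a b).foldl (bAct n) Y = insert b (Y.erase a) := by
  induction b, hab using Nat.le_induction with
  | base => simp [rowWord2_self, Finset.insert_erase hY]
  | succ b h ih =>
    rw [rowWord2_succ n a b h hb, List.foldl_append,
      ih (by omega) (fun c hc h => by have := hY' c hc h; omega)]
    ext k
    have h1 : b + 1 ∉ Y := fun h => by have := hY' _ h; omega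
    have h2 : a < b → b ∉ Y := fun h' h => by have := hY' _ h; omega
    simp only [List.foldl_cons, List.foldl_nil, mem_bAct, Finset.mem_insert, Finset.mem_erase]
    grind

theorem foldl_rowWord (n b : ℕ) (h1 : 1 ≤ b) (hb : b ≤ n) (Y : Finset ℕ)
    (hY' : ∀ c ∈ Y, b < c) :
    (rowWord n b).foldl (bAct n) Y = insert b Y := by
  rw [rowWord_eq]
  induction b, h1 using Nat.le_induction with
  | base =>
    rw [rowWord2_succ n 0 0 le_rfl (by omega), rowWord2_self]
    have : 1 ∉ Y := fun h => by have := hY' _ h; omega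
    simp [bAct, this]
  | succ b h ih =>
    rw [rowWord2_succ n 0 b (by omega) hb, List.foldl_append,
      ih (by omega) (fun c hc => by have := hY' c hc; omega)]
    ext k
    have h1 : b + 1 ∉ Y := fun h => by have := hY' _ h; omega
    have h2 : b ∉ Y := fun h => by have := hY' _ h; omega
    simp only [List.foldl_cons, List.foldl_nil, mem_bAct, Finset.mem_insert]
    grind

theorem foldl_rows (n : ℕ) (L : List ℕ) (hL : L.Pairwise (· > ·))
    (hm : ∀ b ∈ L, 1 ≤ b ∧ b ≤ n) (Y : Finset ℕ) (hY : ∀ c ∈ Y, ∀ b ∈ L, b < c) :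
    ((L.map (rowWord n)).flatten).foldl (bAct n) Y = Y ∪ L.toFinset := by
  induction L generalizing Y with
  | nil => simp
  | cons b L ih =>
    rw [List.pairwise_cons] at hL
    have hb := hm b (by simp)
    rw [List.map_cons, List.flatten_cons, List.foldl_append,
      foldl_rowWord n b hb.1 hb.2 Y (fun c hc => hY c hc b (by simp)),
      ih hL.2 (fun c hc => hm c (by simp [hc]))]
    · ext k; simp
    · intro c hc d hd
      rcases Finset.mem_insert.1 hc with rfl | hc
      · exact hL.1 d hd
      · exact hY c hc d (by simp [hd])

theorem foldl_moves (n : ℕ) (P : List (ℕ × ℕ))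
    (hP : P.Pairwise (fun p q => q.1 < p.1 ∧ q.2 < p.2))
    (hm : ∀ p ∈ P, 1 ≤ p.1 ∧ p.1 ≤ p.2 ∧ p.2 ≤ n) (Y : Finset ℕ)
    (hY : ∀ c ∈ Y, ∀ p ∈ P, p.2 < c) :
    ((P.map fun p => rowWord2 n p.1 p.2).flatten).foldl (bAct n)
      (Y ∪ (P.map Prod.fst).toFinset) = Y ∪ (P.map Prod.snd).toFinset := by
  induction P generalizing Y with
  | nil => simp
  | cons p P ih =>
    rw [List.pairwise_cons] at hP
    have hp := hm p (by simp)
    have hpY : p.1 ∉ Y := fun h => by have := hY _ h p (by simp); omega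
    have hlt : ∀ x ∈ (P.map Prod.fst).toFinset, x < p.1 := by
      intro x hx
      rw [List.mem_toFinset, List.mem_map] at hx
      obtain ⟨q, hq, rfl⟩ := hx
      exact (hP.1 q hq).1
    have hpP : p.1 ∉ (P.map Prod.fst).toFinset := fun h => by have := hlt _ h; omega
    rw [List.map_cons (f := fun p : ℕ × ℕ => rowWord2 n p.1 p.2), List.flatten_cons,
      List.foldl_append, foldl_rowWord2 n p.1 p.2 hp.2.1 hp.1 hp.2.2]
    · have e : insert p.2 ((Y ∪ ((p :: P).map Prod.fst).toFinset).erase p.1)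
          = insert p.2 Y ∪ (P.map Prod.fst).toFinset := by
        ext k
        simp only [List.map_cons, List.toFinset_cons, Finset.mem_insert, Finset.mem_erase,
          Finset.mem_union]
        grind
      rw [e, ih hP.2 (fun c hc => hm c (by simp [hc]))]
      · ext k
        simp only [List.map_cons, List.toFinset_cons, Finset.mem_insert,
          Finset.mem_union]
        tauto
      · intro c hc d hd
        rcases Finset.mem_insert.1 hc with rfl | hc
        · exact (hP.1 d hd).2
        · exact hY c hc d (by simp [hd])
    · simp
    · intro c hc hlt'
      rw [List.map_cons, List.toFinset_cons, Finset.mem_union, Finset.mem_insert] at hc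
      rcases hc with hc | rfl | hc
      · exact hY c hc p (by simp)
      · omega
      · have := hlt c hc; omega

/-- A decreasing list with at least `a + 1` entries `≥ k` has its `a`-th entry `≥ k`. -/
theorem le_getD (D : List ℕ) (hD : D.Pairwise (· > ·)) (k a : ℕ)
    (h : a < (D.toFinset.filter fun x => k ≤ x).card) : k ≤ D.getD a 0 := by
  by_contra hk
  push Not at hk
  have hsub : (D.toFinset.filter fun x => k ≤ x) ⊆ (D.take a).toFinset := by
    intro x hx
    rw [Finset.mem_filter, List.mem_toFinset] at hx
    obtain ⟨hx, hkx⟩ := hx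
    rw [List.mem_iff_getElem] at hx
    obtain ⟨m, hm, rfl⟩ := hx
    have : m < a := by
      by_contra hma
      push Not at hma
      have ha : a < D.length := by omega
      rw [List.getD_eq_getElem _ _ ha] at hk
      rcases hma.eq_or_lt with e | e
      · subst e; omega
      · have := List.pairwise_iff_getElem.1 hD a m ha hm e
        omega
    rw [List.mem_toFinset, List.mem_take_iff_getElem]
    exact ⟨m, by omega, rfl⟩
  have := Finset.card_le_card hsub
  have := (D.take a).toFinset_card_le
  have := List.length_take_le a D
  omega

theorem count_E (n : ℕ) (X : Finset ℕ) (t k : ℕ) (hk : 1 ≤ k) (hkt : k < t) (htn : t ≤ n)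
    (hX : X ⊆ Finset.Icc 1 n)
    (h : (X.filter fun t' => k ≤ t' ∧ t' < t).card
      > ((Finset.Icc 1 n \ X).filter fun t' => k ≤ t' ∧ t' < t).card) :
    t - k < 2 * (X.filter fun t' => k ≤ t' ∧ t' < t).card := by
  have e : (X.filter fun t' => k ≤ t' ∧ t' < t) ∪
      ((Finset.Icc 1 n \ X).filter fun t' => k ≤ t' ∧ t' < t) = Finset.Ico k t := by
    ext x
    simp only [Finset.mem_union, Finset.mem_filter, Finset.mem_sdiff, Finset.mem_Icc,
      Finset.mem_Ico]
    constructor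
    · rintro (h | h) <;> exact h.2
    · intro h
      by_cases hx : x ∈ X
      · exact Or.inl ⟨hx, h⟩
      · exact Or.inr ⟨⟨by omega, hx⟩, h⟩
  have h2 := Finset.card_union_le (X.filter fun t' => k ≤ t' ∧ t' < t)
    ((Finset.Icc 1 n \ X).filter fun t' => k ≤ t' ∧ t' < t)
  rw [e, Nat.card_Ico] at h2
  omega

theorem length_rows (n : ℕ) (L : List ℕ) (hm : ∀ b ∈ L, b ≤ n) :
    ((L.map (rowWord n)).flatten).length = L.sum := by
  induction L with
  | nil => simp
  | cons b L ih =>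
    rw [List.map_cons, List.flatten_cons, List.length_append,
      ih (fun c hc => hm c (by simp [hc])), rowWord_eq,
      length_rowWord2 n 0 b (by omega) (hm b (by simp))]
    simp

theorem length_moves (n : ℕ) (P : List (ℕ × ℕ)) (hm : ∀ p ∈ P, p.1 ≤ p.2 ∧ p.2 ≤ n) :
    ((P.map fun p => rowWord2 n p.1 p.2).flatten).length + (P.map Prod.fst).sum
      = (P.map Prod.snd).sum := by
  induction P with
  | nil => simp
  | cons p P ih =>
    have hp := hm p (by simp)
    have := ih (fun c hc => hm c (by simp [hc]))
    rw [List.map_cons, List.flatten_cons, List.length_append,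
      length_rowWord2 n _ _ hp.1 hp.2]
    simp only [List.map_cons, List.sum_cons]
    omega

theorem of_mem_filter_inst {p : ℕ → Prop} {inst : DecidablePred p} {s : Finset ℕ} {x : ℕ}
    (h : x ∈ @Finset.filter ℕ p inst s) : x ∈ s ∧ p x := Finset.mem_filter.1 h

/-- Let `X = {t₁ > … > t_k} ⊆ [n]`, let `t = tᵢ ∈ E(X)` and `j = t/2`.
With `r₁ = w_{t₁} ++ … ++ w_{t_{i−1}} ++ w_{t−1} ++ w_{t−3} ++ … ++ w₃ ++ w₁` and
`r₂ = w_{t−1,t_{i+1}} ++ w_{t−3,t_{i+2}} ++ … ++ w_{1,t_{i+j}} ++ w_{t_{i+j+1}} ++ … ++ w_{t_k}`,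
the word `r₁ ++ r₂` is reduced and its product is the element of `ᴵW` corresponding to
`X ∖ {t}`; in particular that element has length `ℓ(X) − t`, where `ℓ(X) = t₁ + … + t_k`. -/
theorem stmt_6 (n : ℕ) (hn : 2 ≤ n) {W : Type*} [Group W] (cs : CoxeterSystem (BCox n) W)
    (T : List ℕ) (hT : T.Chain' (· > ·)) (hmem : ∀ t ∈ T, t ∈ Finset.Icc 1 n)
    (i0 : ℕ) (hi0 : i0 < T.length) (t : ℕ) (ht : T.getD i0 0 = t)
    (htE : t ∈ Eset n T.toFinset)
    (r1 r2 : List (Fin n))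
    (hr1 : r1 = ((T.take i0).map (rowWord n)).flatten ++
        ((List.range (t / 2)).map fun a => rowWord n (t - (2 * a + 1))).flatten)
    (hr2 : r2 = ((List.range (t / 2)).map fun a =>
          rowWord2 n (t - (2 * a + 1)) (T.getD (i0 + 1 + a) 0)).flatten ++
        ((T.drop (i0 + t / 2 + 1)).map (rowWord n)).flatten) :
    cs.IsReduced (r1 ++ r2) ∧
    cs.wordProd (r1 ++ r2) ∈ IWset cs ∧
    corr cs (cs.wordProd (r1 ++ r2)) (T.toFinset.erase t) ∧
    cs.length (cs.wordProd (r1 ++ r2)) = T.sum - t := by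
  have hP : T.Pairwise (· > ·) := List.isChain_iff_pairwise.1 hT
  rw [List.getD_eq_getElem _ _ hi0] at ht
  have htT : t ∈ T := ht ▸ List.getElem_mem hi0
  have htn := Finset.mem_Icc.1 (hmem t htT)
  unfold Eset at htE
  obtain ⟨-, hev, hE⟩ := of_mem_filter_inst htE
  obtain ⟨j, hj⟩ := hev
  have hj2 : t / 2 = j := by omega
  rw [hj2] at hr1 hr2
  obtain ⟨A, hA⟩ : ∃ A, A = T.take i0 := ⟨_, rfl⟩
  obtain ⟨D, hDdef⟩ : ∃ D, D = T.drop (i0 + 1) := ⟨_, rfl⟩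
  have hTs : T = A ++ t :: D := by
    rw [hA, hDdef, ← ht, List.getElem_cons_drop, List.take_append_drop]
  have hP' := hP
  rw [hTs, List.pairwise_append, List.pairwise_cons] at hP'
  obtain ⟨hPA, ⟨htD, hPD⟩, hAD⟩ := hP'
  have hAt : ∀ x ∈ A, t < x := fun x hx => hAD x hx t (by simp)
  have hDget : ∀ a, T.getD (i0 + 1 + a) 0 = D.getD a 0 := by
    intro a
    rw [hDdef, List.getD_eq_getElem?_getD, List.getD_eq_getElem?_getD, List.getElem?_drop]
  have key : ∀ a < j, t - (2 * a + 1) ≤ D.getD a 0 := by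
    intro a ha
    apply le_getD D hPD
    have h1 := hE (t - (2 * a + 1)) (Finset.mem_Ico.2 ⟨by omega, by omega⟩)
    have h2 := count_E n T.toFinset t (t - (2 * a + 1)) (by omega) (by omega) htn.2
      (fun x hx => hmem x (List.mem_toFinset.1 hx)) (by convert h1)
    have h3 : (T.toFinset.filter fun t' => t - (2 * a + 1) ≤ t' ∧ t' < t) ⊆
        D.toFinset.filter fun x => t - (2 * a + 1) ≤ x := by
      intro x hx
      simp only [Finset.mem_filter, List.mem_toFinset] at hx ⊢
      refine ⟨?_, hx.2.1⟩
      have hx1 := hx.1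
      rw [hTs, List.mem_append, List.mem_cons] at hx1
      rcases hx1 with h | h | h
      · have := hAt x h; omega
      · omega
      · exact h
    have := Finset.card_le_card h3
    omega
  have hjD : j ≤ D.length := by
    by_contra hlt
    have := key (j - 1) (by omega)
    rw [List.getD_eq_default _ _ (by omega)] at this
    omega
  obtain ⟨P, hPd⟩ : ∃ P : List (ℕ × ℕ), P = (List.range j).map
      (fun a => (t - (2 * a + 1), D.getD a 0)) := ⟨_, rfl⟩
  have hP1 : P.map Prod.fst = (List.range j).map (fun a => t - (2 * a + 1)) := by
    rw [hPd, List.map_map]; rfl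
  have hP2 : P.map Prod.snd = D.take j := by
    rw [hPd, List.map_map]
    apply List.ext_getElem
    · simp [hjD]
    · intro a h1 h2
      simp at h1 h2
      simp [h2]
  obtain ⟨B, hB⟩ : ∃ B, B = D.drop j := ⟨_, rfl⟩
  have hDs : D = P.map Prod.snd ++ B := by rw [hP2, hB, List.take_append_drop]
  have hBT : T.drop (i0 + j + 1) = B := by
    rw [hB, hDdef, List.drop_drop]; congr 1; omega
  rw [hBT] at hr2
  have er1 : r1 = ((A ++ P.map Prod.fst).map (rowWord n)).flatten := by
    rw [hr1, hP1, hA, List.map_append, List.flatten_append, List.map_map]; rfl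
  have er2 : r2 = (P.map fun p => rowWord2 n p.1 p.2).flatten ++ (B.map (rowWord n)).flatten := by
    rw [hr2, hPd, List.map_map]
    simp only [hDget]; rfl
  have hPpair : P.Pairwise (fun p q => q.1 < p.1 ∧ q.2 < p.2) := by
    rw [List.pairwise_iff_getElem]
    intro a b ha hb hab
    have hbj : b < j := by simpa [hPd] using hb
    simp only [hPd, List.getElem_map, List.getElem_range]
    refine ⟨by omega, ?_⟩
    rw [List.getD_eq_getElem _ _ (by omega), List.getD_eq_getElem _ _ (by omega)]
    exact List.pairwise_iff_getElem.1 hPD a b (by omega) (by omega) hab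
  have hmD : ∀ x ∈ D, 1 ≤ x ∧ x ≤ n := fun x hx =>
    Finset.mem_Icc.1 (hmem x (by rw [hTs]; simp [hx]))
  have hmA : ∀ x ∈ A, 1 ≤ x ∧ x ≤ n := fun x hx =>
    Finset.mem_Icc.1 (hmem x (by rw [hTs]; simp [hx]))
  have hmP2 : ∀ p ∈ P, p.2 ∈ D := by
    intro p hp
    rw [hDs]; exact List.mem_append_left _ (List.mem_map_of_mem hp)
  have hmB : ∀ b ∈ B, b ∈ D := fun b hb => by rw [hDs]; exact List.mem_append_right _ hb
  have hmP : ∀ p ∈ P, 1 ≤ p.1 ∧ p.1 ≤ p.2 ∧ p.2 ≤ n := by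
    intro p hp
    have h2 := (hmD _ (hmP2 p hp)).2
    rw [hPd, List.mem_map] at hp
    obtain ⟨a, ha, rfl⟩ := hp
    rw [List.mem_range] at ha
    exact ⟨by dsimp only; omega, key a ha, h2⟩
  have hP1m : ∀ x ∈ P.map Prod.fst, 1 ≤ x ∧ x ≤ n ∧ x < t := by
    intro x hx
    rw [List.mem_map] at hx
    obtain ⟨p, hp, rfl⟩ := hx
    have := hmP p hp
    have := htD _ (hmP2 p hp)
    omega
  have hsplit : (P.map Prod.snd).Pairwise (· > ·) ∧ B.Pairwise (· > ·) ∧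
      ∀ x ∈ P.map Prod.snd, ∀ y ∈ B, x > y := by
    rw [hDs] at hPD; exact List.pairwise_append.1 hPD
  have hfold : (r1 ++ r2).foldl (bAct n) ∅ = T.toFinset.erase t := by
    rw [List.foldl_append, er1, er2, List.foldl_append, foldl_rows n (A ++ P.map Prod.fst)]
    · rw [Finset.empty_union, List.toFinset_append, foldl_moves n P hPpair hmP, foldl_rows n B hsplit.2.1 (fun b hb => hmD b (hmB b hb))]
      · rw [hTs, hDs]
        ext x
        simp only [Finset.mem_union, Finset.mem_erase, List.mem_toFinset, List.mem_append,
          List.mem_cons]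
        have h1 : x ∈ A → x ≠ t := fun h => by have := hAt x h; omega
        have h2 : x ∈ D → x ≠ t := fun h => by have := htD x h; omega
        rw [hDs, List.mem_append] at h2
        tauto
      · intro c hc b hb
        rw [Finset.mem_union, List.mem_toFinset, List.mem_toFinset] at hc
        rcases hc with hc | hc
        · have := hAt c hc
          have := htD b (hmB b hb)
          omega
        · exact hsplit.2.2 c hc b hb
      · intro c hc p hp
        have := hAt c (List.mem_toFinset.1 hc)
        have := htD _ (hmP2 p hp)
        omega
    · rw [List.pairwise_append]
      refine ⟨hPA, ?_, ?_⟩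
      · rw [List.pairwise_map]
        exact hPpair.imp (fun h => h.1)
      · intro a ha b hb
        have := hAt a ha
        have := hP1m b hb
        omega
    · intro b hb
      rcases List.mem_append.1 hb with hb | hb
      · exact hmA b hb
      · exact ⟨(hP1m b hb).1, (hP1m b hb).2.1⟩
    · simp
  have hsum : (T.toFinset.erase t).sum id = T.sum - t := by
    have h1 := Finset.add_sum_erase T.toFinset id (List.mem_toFinset.2 htT)
    have hnd : T.Nodup := hP.imp (fun h => by omega)
    have h2 := List.sum_toFinset id hnd
    simp only [List.map_id] at h2
    rw [h2] at h1
    simp only [id] at h1 ⊢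
    omega
  have hlen : (r1 ++ r2).length = (T.toFinset.erase t).sum id := by
    rw [hsum, er1, er2, List.length_append, List.length_append, length_rows n, length_rows n]
    · have := length_moves n P (fun p hp => (hmP p hp).2)
      have h2 : T.sum = A.sum + (t + ((P.map Prod.snd).sum + B.sum)) := by
        rw [hTs, hDs]; simp
      rw [List.sum_append]
      omega
    · exact fun b hb => (hmD b (hmB b hb)).2
    · intro b hb
      rcases List.mem_append.1 hb with hb | hb
      · exact (hmA b hb).2
      · exact (hP1m b hb).2.1
  have := good_word cs (r1 ++ r2) _ hfold hlen
  rwa [hsum] at this
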